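/- Let d ≥ 3 be odd and f = x^d + y^d + z^d − (x + y + z)^d (generalized Cayley plane curve). Then the set of singular points of the curve V : f = 0 in ℙ² is exactly the set of points (1 : u : −u), (u : 1 : −u) and (u : −u : 1) with u ranging over the (d−1)-st roots of unity, and this set has exactly 3(d−2) elements. -/

import Mathlib

open MvPolynomial

lemma aux_eval (d : ℕ) (hd : 3 ≤ d) (p : Fin 3 → ℂ) :
    (∀ i, eval p (pderiv i ((X 0) ^ d + (X 1) ^ d + (X 2) ^ d - (X 0 + X 1 + X 2) ^ d :
      MvPolynomial (Fin 3) ℂ)) = 0) ↔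
    (p 0 ^ (d-1) = (p 0 + p 1 + p 2)^(d-1) ∧ p 1 ^ (d-1) = (p 0 + p 1 + p 2)^(d-1) ∧
      p 2 ^ (d-1) = (p 0 + p 1 + p 2)^(d-1)) := by
  have hd0 : (d : ℂ) ≠ 0 := by
    have : d ≠ 0 := by omega
    exact_mod_cast this
  rw [Fin.forall_fin_succ, Fin.forall_fin_two]
  have key : ∀ a b : ℂ, (d : ℂ) * a - d * b = 0 ↔ a = b := by
    intro a b
    rw [← mul_sub, mul_eq_zero, sub_eq_zero]
    simp [hd0]
  simp [pderiv_pow, pderiv_X, Pi.single_apply, key]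

lemma aux_norm (n : ℕ) (hn : n ≠ 0) (a : ℂ) (h : a ^ n = 1) : a * (starRingEnd ℂ) a = 1 := by
  have := Complex.norm_eq_one_of_pow_eq_one h hn
  rw [Complex.mul_conj, Complex.normSq_eq_norm_sq, this]; simp

lemma aux_rhombus (n : ℕ) (hn : n ≠ 0) (b c : ℂ) (hb : b ^ n = 1) (hc : c ^ n = 1)
    (hs : (1 + b + c) ^ n = 1) : 1 + b = 0 ∨ 1 + c = 0 ∨ b + c = 0 := by
  have h1 := aux_norm n hn b hb
  have h2 := aux_norm n hn c hc
  have h3 := aux_norm n hn _ hs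
  simp only [map_add, map_one] at h3
  have : (1 + b) * ((1 + c) * (b + c)) = 0 := by
    linear_combination (b * c) * h3 - (1+b+c) * c * h1 - (1+b+c) * b * h2
  simpa [mul_eq_zero] using this

lemma aux_part1 (d : ℕ) (hd : 3 ≤ d) (hodd : Odd d) (p : Fin 3 → ℂ) :
    (p ≠ 0 ∧ (p 0 ^ (d-1) = (p 0 + p 1 + p 2)^(d-1) ∧ p 1 ^ (d-1) = (p 0 + p 1 + p 2)^(d-1) ∧
      p 2 ^ (d-1) = (p 0 + p 1 + p 2)^(d-1))) ↔ ∃ c : ℂ, c ≠ 0 ∧ ∃ u : ℂ, u ^ (d - 1) = 1 ∧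
        (p = c • ![1, u, -u] ∨ p = c • ![u, 1, -u] ∨ p = c • ![u, -u, 1]) := by
  have hn : d - 1 ≠ 0 := by omega
  have he : Even (d - 1) := by
    obtain ⟨k, rfl⟩ := hodd
    exact ⟨k, by omega⟩
  generalize d - 1 = n at *
  constructor
  · rintro ⟨hp, h0, h1, h2⟩
    have hx : p 0 ≠ 0 := by
      intro hx
      rw [hx, zero_pow hn] at h0
      rw [hx, ← h0, pow_eq_zero_iff hn] at h1
      rw [hx, ← h0, pow_eq_zero_iff hn] at h2
      apply hp
      ext i; fin_cases i <;> simp [hx, h1, h2]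
    have hb : (p 1 / p 0) ^ n = 1 := by
      rw [div_pow, h1, ← h0, div_self (pow_ne_zero _ hx)]
    have hc : (p 2 / p 0) ^ n = 1 := by
      rw [div_pow, h2, ← h0, div_self (pow_ne_zero _ hx)]
    have hs : (1 + p 1 / p 0 + p 2 / p 0) ^ n = 1 := by
      have : 1 + p 1 / p 0 + p 2 / p 0 = (p 0 + p 1 + p 2) / p 0 := by field_simp
      rw [this, div_pow, ← h0, div_self (pow_ne_zero _ hx)]
    have hy : p 1 ≠ 0 := by
      intro h; rw [h, zero_div, zero_pow hn] at hb; simp at hb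
    have hz : p 2 ≠ 0 := by
      intro h; rw [h, zero_div, zero_pow hn] at hc; simp at hc
    rcases aux_rhombus n hn _ _ hb hc hs with h | h | h
    · refine ⟨p 2, hz, p 0 / p 2, ?_, Or.inr (Or.inr ?_)⟩
      · rw [← inv_div, inv_pow, hc, inv_one]
      · field_simp at h
        have h' : p 1 = - p 0 := by linear_combination h
        ext i; fin_cases i <;> simp [h'] <;> field_simp
    · refine ⟨p 1, hy, p 0 / p 1, ?_, Or.inr (Or.inl ?_)⟩
      · rw [← inv_div, inv_pow, hb, inv_one]
      · field_simp at h
        have h' : p 2 = - p 0 := by linear_combination h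
        ext i; fin_cases i <;> simp [h'] <;> field_simp
    · refine ⟨p 0, hx, p 1 / p 0, hb, Or.inl ?_⟩
      field_simp at h
      have h' : p 2 = - p 1 := by linear_combination h
      ext i; fin_cases i <;> simp [h'] <;> field_simp
  · rintro ⟨c, hc, u, hu, rfl | rfl | rfl⟩
    · refine ⟨fun h => hc (by simpa using congrFun h 0), ?_⟩
      simp [mul_pow, hu, he.neg_pow]
    · refine ⟨fun h => hc (by simpa using congrFun h 1), ?_⟩
      have : c * u + c + -(c * u) = c := by ring
      simp [mul_pow, hu, he.neg_pow, this]
    · refine ⟨fun h => hc (by simpa using congrFun h 2), ?_⟩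
      simp [mul_pow, hu, he.neg_pow]

lemma aux_ne (b : ℂ × ℂ) : (![1, b.1, b.2] : Fin 3 → ℂ) ≠ 0 :=
  fun h => one_ne_zero (α := ℂ) (by simpa using congrFun h 0)

lemma aux_card (n : ℕ) (hn : n ≠ 0) (he : Even n) :
    {q : ℂ × ℂ | ∃ u : ℂ, u ^ n = 1 ∧ (q = (u, -u) ∨ q = (u, -1) ∨ q = (-1, u))}.ncard
      = 3 * (n - 1) := by
  classical
  set R := Polynomial.nthRootsFinset n (1 : ℂ) with hR
  have hm : ∀ u, u ∈ R ↔ u ^ n = 1 := fun u =>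
    Polynomial.mem_nthRootsFinset (Nat.pos_of_ne_zero hn) _
  have hcard : R.card = n := (Complex.isPrimitiveRoot_exp n hn).card_nthRootsFinset
  have h1 : (1 : ℂ) ∈ R := by simp [hm]
  have h2 : (-1 : ℂ) ∈ R.erase 1 := by
    rw [Finset.mem_erase, hm, he.neg_pow, one_pow]
    exact ⟨by norm_num, rfl⟩
  have hS : {q : ℂ × ℂ | ∃ u : ℂ, u ^ n = 1 ∧ (q = (u, -u) ∨ q = (u, -1) ∨ q = (-1, u))} =
      ↑((R.image (fun u => (u, -u)) ∪ (R.erase 1).image (fun u => (u, (-1 : ℂ)))) ∪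
        ((R.erase 1).erase (-1)).image (fun u => ((-1 : ℂ), u))) := by
    ext ⟨a, b⟩
    simp only [Set.mem_ofPred_eq, Finset.coe_union, Finset.coe_image, Set.mem_union, Set.mem_image,
      Finset.mem_coe, Finset.mem_erase, hm, Prod.mk.injEq]
    constructor
    · rintro ⟨u, hu, ⟨rfl, rfl⟩ | ⟨rfl, rfl⟩ | ⟨rfl, rfl⟩⟩
      · exact Or.inl (Or.inl ⟨a, hu, rfl, rfl⟩)
      · by_cases h : a = 1
        · subst h; exact Or.inl (Or.inl ⟨1, hu, rfl, rfl⟩)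
        · exact Or.inl (Or.inr ⟨a, ⟨h, hu⟩, rfl, rfl⟩)
      · by_cases h : b = 1
        · subst h; exact Or.inl (Or.inl ⟨-1, by rw [he.neg_pow, one_pow], rfl, by simp⟩)
        · by_cases h' : b = -1
          · subst h'; exact Or.inl (Or.inr ⟨-1, ⟨h, hu⟩, rfl, rfl⟩)
          · exact Or.inr ⟨b, ⟨h', h, hu⟩, rfl, rfl⟩
    · rintro ((⟨u, hu, rfl, rfl⟩ | ⟨u, ⟨h, hu⟩, rfl, rfl⟩) | ⟨u, ⟨h, h', hu⟩, rfl, rfl⟩)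
      · exact ⟨u, hu, by simp⟩
      · exact ⟨u, hu, by simp⟩
      · exact ⟨u, hu, by simp⟩
  rw [hS, Set.ncard_coe_finset, Finset.card_union_of_disjoint, Finset.card_union_of_disjoint,
    Finset.card_image_of_injective, Finset.card_image_of_injective,
    Finset.card_image_of_injective, Finset.card_erase_of_mem h2, Finset.card_erase_of_mem h1, hcard]
  · obtain ⟨k, rfl⟩ := he
    omega
  · intro a b h; simpa using h
  · intro a b h; simpa using h
  · intro a b h; simpa using h
  · rw [Finset.disjoint_left]
    rintro ⟨a, b⟩ h h'
    simp only [Finset.mem_image, Finset.mem_erase, Prod.mk.injEq] at h h'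
    obtain ⟨u, hu, rfl, rfl⟩ := h
    obtain ⟨v, ⟨hv, -⟩, rfl, h⟩ := h'
    exact hv (by linear_combination h)
  · rw [Finset.disjoint_left]
    rintro ⟨a, b⟩ h h'
    simp only [Finset.mem_union, Finset.mem_image, Finset.mem_erase, Prod.mk.injEq] at h h'
    obtain ⟨v, ⟨hv, hv', -⟩, rfl, rfl⟩ := h'
    rcases h with ⟨u, hu, rfl, h⟩ | ⟨u, hu, rfl, h⟩
    · exact hv' (by linear_combination -h)
    · exact hv h.symm

/-- Let `d ≥ 3` be odd and `f = x^d + y^d + z^d - (x + y + z)^d` (generalized Cayley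
plane curve).  The set of singular points of `V : f = 0` in `ℙ²` is exactly the set of
points `(1 : u : -u)`, `(u : 1 : -u)`, `(u : -u : 1)` with `u^(d-1) = 1`, and it has
exactly `3 (d - 2)` elements. -/
theorem stmt11 (d : ℕ) (hd : 3 ≤ d) (hodd : Odd d)
    (f : MvPolynomial (Fin 3) ℂ)
    (hf : f = (X 0) ^ d + (X 1) ^ d + (X 2) ^ d - (X 0 + X 1 + X 2) ^ d) :
    ({p : Fin 3 → ℂ | p ≠ 0 ∧ ∀ i, eval p (pderiv i f) = 0} =
      {p : Fin 3 → ℂ | ∃ c : ℂ, c ≠ 0 ∧ ∃ u : ℂ, u ^ (d - 1) = 1 ∧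
        (p = c • ![1, u, -u] ∨ p = c • ![u, 1, -u] ∨ p = c • ![u, -u, 1])}) ∧
    {x : Projectivization ℂ (Fin 3 → ℂ) |
      ∀ i, eval x.rep (pderiv i f) = 0}.ncard = 3 * (d - 2) := by
  have main : ∀ p : Fin 3 → ℂ, (p ≠ 0 ∧ ∀ i, eval p (pderiv i f) = 0) ↔
      ∃ c : ℂ, c ≠ 0 ∧ ∃ u : ℂ, u ^ (d - 1) = 1 ∧
        (p = c • ![1, u, -u] ∨ p = c • ![u, 1, -u] ∨ p = c • ![u, -u, 1]) := by
    intro p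
    rw [hf, aux_eval d hd, aux_part1 d hd hodd]
  refine ⟨Set.ext main, ?_⟩
  have hn : d - 1 ≠ 0 := by omega
  have he : Even (d - 1) := by
    obtain ⟨k, rfl⟩ := hodd
    exact ⟨k, by omega⟩
  have hcard := aux_card (d - 1) hn he
  rw [show d - 1 - 1 = d - 2 by omega] at hcard
  have hinj : Function.Injective
      (fun q : ℂ × ℂ => Projectivization.mk ℂ (![1, q.1, q.2] : Fin 3 → ℂ) (aux_ne q)) := by
    rintro ⟨a, b⟩ ⟨a', b'⟩ h
    obtain ⟨t, ht⟩ := (Projectivization.mk_eq_mk_iff' _ _ _ _ _).1 h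
    have e0 := congrFun ht 0
    have e1 := congrFun ht 1
    have e2 := congrFun ht 2
    simp at e0 e1 e2
    subst e0
    simp at e1 e2
    simp [e1, e2]
  rw [← hcard, ← Set.ncard_image_of_injective _ hinj]
  congr 1
  ext x
  have hx : (∀ i, eval x.rep (pderiv i f) = 0) ↔ _ :=
    (iff_and_self.2 (fun _ => x.rep_nonzero)).trans (main x.rep)
  simp only [Set.mem_ofPred_eq, Set.mem_image]
  rw [hx]
  constructor
  · rintro ⟨c, hc, u, hu, h⟩
    have hu0 : u ≠ 0 := by
      rintro rfl; rw [zero_pow hn] at hu; simp at hu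
    have hi : u⁻¹ ^ (d - 1) = 1 := by rw [inv_pow, hu, inv_one]
    rcases h with h | h | h
    · refine ⟨(u, -u), ⟨u, hu, by simp⟩, ?_⟩
      rw [← x.mk_rep, Projectivization.mk_eq_mk_iff']
      refine ⟨c⁻¹, ?_⟩
      rw [h]; ext i; fin_cases i <;> simp [hc]
    · refine ⟨(u⁻¹, -1), ⟨u⁻¹, hi, by simp⟩, ?_⟩
      rw [← x.mk_rep, Projectivization.mk_eq_mk_iff']
      refine ⟨c⁻¹ * u⁻¹, ?_⟩
      rw [h]; ext i; fin_cases i <;> simp <;> field_simp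
    · refine ⟨(-1, u⁻¹), ⟨u⁻¹, hi, by simp⟩, ?_⟩
      rw [← x.mk_rep, Projectivization.mk_eq_mk_iff']
      refine ⟨c⁻¹ * u⁻¹, ?_⟩
      rw [h]; ext i; fin_cases i <;> simp <;> field_simp
  · rintro ⟨q, ⟨u, hu, h⟩, rfl⟩
    obtain ⟨a, ha⟩ := Projectivization.exists_smul_eq_mk_rep ℂ _ (aux_ne q)
    rw [← ha]
    have hu0 : u ≠ 0 := by
      rintro rfl; rw [zero_pow hn] at hu; simp at hu
    have hi : u⁻¹ ^ (d - 1) = 1 := by rw [inv_pow, hu, inv_one]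
    rcases h with rfl | rfl | rfl
    · exact ⟨a, a.ne_zero, u, hu, Or.inl rfl⟩
    · refine ⟨a * u, mul_ne_zero a.ne_zero hu0, u⁻¹, hi, Or.inr (Or.inl ?_)⟩
      ext i; fin_cases i <;> simp [Units.smul_def, hu0]
    · refine ⟨a * u, mul_ne_zero a.ne_zero hu0, u⁻¹, hi, Or.inr (Or.inr ?_)⟩
      ext i; fin_cases i <;> simp [Units.smul_def, hu0]
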